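/- Let λ_1, λ_2, λ_3 be real numbers such that the Bell-diagonal two-qubit matrix ψ_D = (1/4)·(I₄ + λ_1 σ_1⊗σ_1 + λ_2 σ_2⊗σ_2 + λ_3 σ_3⊗σ_3) is positive semidefinite and λ_2² + λ_3²·(λ_1² + λ_2² + λ_3²) > 0, and let ρ be the two-copy state ψ_D ⊗ ψ_D on ℂ⁴ ⊗ ℂ⁴, arranged so that Alice's two qubit factors are grouped together and Bob's two qubit factors are grouped together. Then there exist dichotomic observables A_1, …, A_8 and B_1, …, B_4 on ℂ⁴ such that the n = 4 Bell value satisfies 𝓘_4(A, B, ρ) = 8·√(λ_2² + λ_3²·(λ_1² + λ_2² + λ_3²)). -/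

import Mathlib

open Matrix Kronecker BigOperators
open scoped ComplexOrder

noncomputable section

/-- A dichotomic observable: a Hermitian matrix squaring to the identity. -/
def IsDichotomic {I : Type} [Fintype I] [DecidableEq I] (O : Matrix I I ℂ) : Prop :=
  O.IsHermitian ∧ O * O = 1

/-- A density matrix: positive semidefinite with trace one. -/
def IsDensity {I : Type} [Fintype I] [DecidableEq I] (ρ : Matrix I I ℂ) : Prop :=
  ρ.PosSemidef ∧ ρ.trace = 1

/-- The sign `(-1)^{z_y^x}`, where `z_y^x` is the bit in position `n - y`
(here `y : Fin n` represents the setting `y+1` and `x : Fin (2^(n-1))` represents `x+1`,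
so the bit is that of `x` in position `n - 1 - y`). -/
def bellSign (n : ℕ) (y : Fin n) (x : Fin (2 ^ (n - 1))) : ℝ :=
  if (x : ℕ).testBit (n - 1 - (y : ℕ)) then -1 else 1

/-- The Bell value `𝓘_n(A, B, ρ) = Σ_y Σ_x (-1)^{z_y^x} Tr[(A_x ⊗ B_y) ρ]`. -/
def bellValue (n : ℕ) {IA IB : Type} [Fintype IA] [Fintype IB]
    (A : Fin (2 ^ (n - 1)) → Matrix IA IA ℂ) (B : Fin n → Matrix IB IB ℂ)
    (ρ : Matrix (IA × IB) (IA × IB) ℂ) : ℝ :=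
  ∑ y : Fin n, ∑ x : Fin (2 ^ (n - 1)), bellSign n y x * (((A x ⊗ₖ B y) * ρ).trace).re

/-- The four Pauli matrices `σ_0 = I, σ_1, σ_2, σ_3`. -/
def pauli4 : Fin 4 → Matrix (Fin 2) (Fin 2) ℂ :=
  ![1, !![0, 1; 1, 0], !![0, -Complex.I; Complex.I, 0], !![1, 0; 0, -1]]

/-- The Pauli string `P(a) = σ_{a(1)} ⊗ ⋯ ⊗ σ_{a(m)}`, realized on the `m`-qubit
index type `Fin m → Fin 2` (entrywise Kronecker product). -/
def pauliString (m : ℕ) (a : Fin m → Fin 4) :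
    Matrix (Fin m → Fin 2) (Fin m → Fin 2) ℂ :=
  Matrix.of fun i j => ∏ k : Fin m, pauli4 (a k) (i k) (j k)

/-- The Bell-diagonal two-qubit matrix
`ψ_D = (1/4)(I + λ₁ σ₁⊗σ₁ + λ₂ σ₂⊗σ₂ + λ₃ σ₃⊗σ₃)`. -/
def bellDiag (l1 l2 l3 : ℝ) : Matrix ((Fin 2) × (Fin 2)) ((Fin 2) × (Fin 2)) ℂ :=
  (1 / 4 : ℂ) • (1 + (l1 : ℂ) • (pauli4 1 ⊗ₖ pauli4 1) +
    (l2 : ℂ) • (pauli4 2 ⊗ₖ pauli4 2) + (l3 : ℂ) • (pauli4 3 ⊗ₖ pauli4 3))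

/-- The `m`-fold copy `ψ^{⊗m}` with all of Alice's qubit factors grouped together and
all of Bob's qubit factors grouped together. -/
def copies (m : ℕ) (ψ : Matrix ((Fin 2) × (Fin 2)) ((Fin 2) × (Fin 2)) ℂ) :
    Matrix ((Fin m → Fin 2) × (Fin m → Fin 2)) ((Fin m → Fin 2) × (Fin m → Fin 2)) ℂ :=
  Matrix.of fun p q => ∏ k : Fin m, ψ (p.1 k, p.2 k) (q.1 k, q.2 k)

/-- The grouped two-copy state `ψ ⊗ ψ` on `(ℂ²⊗ℂ²) ⊗ (ℂ²⊗ℂ²)`: Alice's two qubit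
factors are grouped together and Bob's two qubit factors are grouped together. -/
def twoCopies (ψ : Matrix ((Fin 2) × (Fin 2)) ((Fin 2) × (Fin 2)) ℂ) :
    Matrix (((Fin 2) × (Fin 2)) × ((Fin 2) × (Fin 2)))
      (((Fin 2) × (Fin 2)) × ((Fin 2) × (Fin 2))) ℂ :=
  Matrix.of fun p q =>
    ψ (p.1.1, p.2.1) (q.1.1, q.2.1) * ψ (p.1.2, p.2.2) (q.1.2, q.2.2)

lemma bellSign_mul_self (n : ℕ) (y : Fin n) (x : Fin (2 ^ (n - 1))) :
    bellSign n y x * bellSign n y x = 1 := by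
  unfold bellSign
  split_ifs <;> norm_num

/-- A real unit vector in the span of Hermitian matrices satisfying the Clifford relations is a
dichotomic observable. -/
lemma isDichotomic_sum_smul_of_clifford {I J : Type} [Fintype I] [DecidableEq I] [Fintype J]
    [DecidableEq J] (G : J → Matrix I I ℂ) (hG : ∀ j, (G j).IsHermitian)
    (hcliff : ∀ j k, G j * G k + G k * G j = if j = k then 2 else 0)
    (c : J → ℝ) (hc : ∑ j, c j ^ 2 = 1) :
    IsDichotomic (∑ j, (c j : ℂ) • G j) := by
  refine ⟨?_, ?_⟩
  · simp only [IsHermitian, conjTranspose_sum, conjTranspose_smul, (hG _).eq, RCLike.star_def,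
      Complex.conj_ofReal]
  · have hexp : (∑ j, (c j : ℂ) • G j) * (∑ j, (c j : ℂ) • G j) =
        ∑ j, ∑ k, ((c j : ℂ) * c k) • (G j * G k) := by
      simp only [Finset.sum_mul_sum, smul_mul_smul_comm]
    have hswap : ∑ j, ∑ k, ((c j : ℂ) * c k) • (G j * G k) =
        ∑ j, ∑ k, ((c j : ℂ) * c k) • (G k * G j) := by
      rw [Finset.sum_comm]
      simp only [mul_comm]
    have hc' : ∑ j, (c j : ℂ) * c j = 1 := by
      have := congrArg (fun r : ℝ => (r : ℂ)) hc
      simpa [sq] using this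
    have htwo : (2 : ℂ) • ((∑ j, (c j : ℂ) • G j) * (∑ j, (c j : ℂ) • G j)) =
        (2 : ℂ) • (1 : Matrix I I ℂ) := by
      rw [two_smul ℂ (_ * _)]
      nth_rewrite 2 [hexp]
      rw [hswap, hexp]
      simp only [← Finset.sum_add_distrib, ← smul_add, hcliff, smul_ite, smul_zero,
        Finset.sum_ite_eq, Finset.mem_univ, if_true]
      rw [← Finset.sum_smul, hc', one_smul, two_smul, one_add_one_eq_two]
    exact smul_right_injective _ (two_ne_zero' ℂ) htwo

lemma IsDichotomic.of_clifford {I J : Type} [Fintype I] [DecidableEq I] [DecidableEq J]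
    (G : J → Matrix I I ℂ) (hG : ∀ j, (G j).IsHermitian)
    (hcliff : ∀ j k, G j * G k + G k * G j = if j = k then 2 else 0) (j : J) :
    IsDichotomic (G j) := by
  refine ⟨hG j, smul_right_injective _ (two_ne_zero' ℂ) ?_⟩
  have := hcliff j j
  rw [if_pos rfl] at this
  simp only [two_smul, this, one_add_one_eq_two]

/-- Bell value reached by Clifford observables with diagonal correlations `t`, when the other party
measures along the signed normalised vector `t`. -/
lemma bellValue_clifford {n : ℕ} {IA IB : Type} [Fintype IA] [Fintype IB]
    (G : Fin n → Matrix IA IA ℂ) (H : Fin n → Matrix IB IB ℂ)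
    (ρ : Matrix (IA × IB) (IA × IB) ℂ) (t : Fin n → ℝ)
    (hcorr : ∀ j k, ((G j ⊗ₖ H k) * ρ).trace = if j = k then (t j : ℂ) else 0) :
    bellValue n (fun x => ∑ j, ((bellSign n j x * (t j / √(∑ k, t k ^ 2)) : ℝ) : ℂ) • G j) H ρ =
      2 ^ (n - 1) * √(∑ k, t k ^ 2) := by
  have hkron (x) (y) : (∑ j, ((bellSign n j x * (t j / √(∑ k, t k ^ 2)) : ℝ) : ℂ) • G j) ⊗ₖ H y =
      ∑ j, ((bellSign n j x * (t j / √(∑ k, t k ^ 2)) : ℝ) : ℂ) • (G j ⊗ₖ H y) := by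
    ext p q
    simp only [kroneckerMap_apply, Matrix.sum_apply, Matrix.smul_apply, smul_eq_mul,
      Finset.sum_mul, mul_assoc]
  have hterm (x) (y) : bellSign n y x * (((∑ j, ((bellSign n j x * (t j / √(∑ k, t k ^ 2)) : ℝ) : ℂ)
      • G j) ⊗ₖ H y * ρ).trace).re = t y ^ 2 / √(∑ k, t k ^ 2) := by
    rw [hkron]
    simp only [Finset.sum_mul, Matrix.smul_mul, trace_sum, trace_smul, hcorr, smul_eq_mul, mul_ite,
      mul_zero, Finset.sum_ite_eq', Finset.mem_univ, if_true, ← Complex.ofReal_mul,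
      Complex.ofReal_re]
    linear_combination (t y ^ 2 / √(∑ k, t k ^ 2)) * bellSign_mul_self n y x
  simp only [bellValue, hterm, Finset.sum_const, Finset.card_univ, Fintype.card_fin, nsmul_eq_mul]
  rw [← Finset.mul_sum, ← Finset.sum_div, Real.div_sqrt]
  push_cast
  rfl

lemma pauli4_isHermitian (i : Fin 4) : (pauli4 i).IsHermitian := by
  ext a b
  fin_cases i <;> fin_cases a <;> fin_cases b <;> simp [pauli4]

lemma pauli4_mul_self (i : Fin 4) : pauli4 i * pauli4 i = 1 := by
  ext a b
  fin_cases i <;> fin_cases a <;> fin_cases b <;> simp [pauli4]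

lemma pauli4_mul_eq_neg {i j : Fin 4} (hi : i ≠ 0) (hj : j ≠ 0) (hij : i ≠ j) :
    pauli4 i * pauli4 j = -(pauli4 j * pauli4 i) := by
  ext a b
  fin_cases i <;> fin_cases j <;> first
    | contradiction
    | (fin_cases a <;> fin_cases b <;> simp [pauli4])

lemma trace_kronecker_mul_twoCopies (X₁ X₂ Y₁ Y₂ : Matrix (Fin 2) (Fin 2) ℂ)
    (ψ : Matrix (Fin 2 × Fin 2) (Fin 2 × Fin 2) ℂ) :
    (((X₁ ⊗ₖ X₂) ⊗ₖ (Y₁ ⊗ₖ Y₂)) * twoCopies ψ).trace =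
      ((X₁ ⊗ₖ Y₁) * ψ).trace * ((X₂ ⊗ₖ Y₂) * ψ).trace := by
  simp only [trace, diag_apply, mul_apply, kroneckerMap_apply, twoCopies, of_apply,
    Fintype.sum_prod_type, Fin.sum_univ_two]
  ring

lemma trace_pauli4_kronecker_mul_bellDiag (l1 l2 l3 : ℝ) (i j : Fin 4) :
    ((pauli4 i ⊗ₖ pauli4 j) * bellDiag l1 l2 l3).trace =
      if i = j then ((![1, l1, l2, l3] i : ℝ) : ℂ) else 0 := by
  fin_cases i <;> fin_cases j <;>
    simp [trace, mul_apply, bellDiag, pauli4, Fintype.sum_prod_type, Fin.sum_univ_two,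
      Matrix.one_apply] <;> ring_nf

/-- The anticommuting two-qubit observables `σ₂ ⊗ I`, `σ₃ ⊗ σ₁`, `σ₃ ⊗ σ₂`, `σ₃ ⊗ σ₃`. -/
def twoQubitClifford (y : Fin 4) : Matrix (Fin 2 × Fin 2) (Fin 2 × Fin 2) ℂ :=
  pauli4 (![2, 3, 3, 3] y) ⊗ₖ pauli4 y

lemma twoQubitClifford_isHermitian (y : Fin 4) : (twoQubitClifford y).IsHermitian := by
  rw [IsHermitian, twoQubitClifford, conjTranspose_kronecker, (pauli4_isHermitian _).eq,
    (pauli4_isHermitian _).eq]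

lemma twoQubitClifford_anticommutator (j k : Fin 4) :
    twoQubitClifford j * twoQubitClifford k + twoQubitClifford k * twoQubitClifford j =
      if j = k then 2 else 0 := by
  have hfirst (i : Fin 4) (hi : i ≠ 0) : (![2, 3, 3, 3] : Fin 4 → Fin 4) i = 3 := by
    fin_cases i <;> simp_all
  have hzero : (![2, 3, 3, 3] : Fin 4 → Fin 4) 0 = 2 := rfl
  have hone : pauli4 0 = 1 := rfl
  have h23 : pauli4 2 * pauli4 3 = -(pauli4 3 * pauli4 2) :=
    pauli4_mul_eq_neg (by decide) (by decide) (by decide)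
  simp only [twoQubitClifford, ← mul_kronecker_mul]
  split_ifs with hjk
  · rw [hjk, pauli4_mul_self, pauli4_mul_self, one_kronecker_one, one_add_one_eq_two]
  · rcases eq_or_ne j 0 with rfl | hj
    · rw [hzero, hfirst k (Ne.symm hjk), hone, one_mul, mul_one, ← add_kronecker, h23,
        neg_add_cancel, zero_kronecker]
    · rcases eq_or_ne k 0 with rfl | hk
      · rw [hzero, hfirst j hj, hone, one_mul, mul_one, ← add_kronecker, h23,
          add_neg_cancel, zero_kronecker]
      · rw [hfirst j hj, hfirst k hk, ← kronecker_add, pauli4_mul_eq_neg hj hk hjk,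
          neg_add_cancel, kronecker_zero]

lemma trace_twoQubitClifford_kronecker_mul_twoCopies (l1 l2 l3 : ℝ) (j k : Fin 4) :
    ((twoQubitClifford j ⊗ₖ twoQubitClifford k) * twoCopies (bellDiag l1 l2 l3)).trace =
      if j = k then ((![l2, l3 * l1, l3 * l2, l3 * l3] j : ℝ) : ℂ) else 0 := by
  rw [twoQubitClifford, twoQubitClifford, trace_kronecker_mul_twoCopies,
    trace_pauli4_kronecker_mul_bellDiag, trace_pauli4_kronecker_mul_bellDiag]
  fin_cases j <;> fin_cases k <;> simp

/-- for two copies of a Bell-diagonal state with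
`λ₂² + λ₃²(λ₁²+λ₂²+λ₃²) > 0`, there exist dichotomic observables achieving the `n = 4`
Bell value `8·√(λ₂² + λ₃²(λ₁²+λ₂²+λ₃²))`. -/
theorem two_copies_bell_diag_n4_value
    (l1 l2 l3 : ℝ) (hψ : (bellDiag l1 l2 l3).PosSemidef)
    (hpos : 0 < l2 ^ 2 + l3 ^ 2 * (l1 ^ 2 + l2 ^ 2 + l3 ^ 2)) :
    ∃ (A : Fin (2 ^ (4 - 1)) → Matrix ((Fin 2) × (Fin 2)) ((Fin 2) × (Fin 2)) ℂ)
      (B : Fin 4 → Matrix ((Fin 2) × (Fin 2)) ((Fin 2) × (Fin 2)) ℂ),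
      (∀ x, IsDichotomic (A x)) ∧ (∀ y, IsDichotomic (B y)) ∧
      bellValue 4 A B (twoCopies (bellDiag l1 l2 l3)) =
        8 * Real.sqrt (l2 ^ 2 + l3 ^ 2 * (l1 ^ 2 + l2 ^ 2 + l3 ^ 2)) := by
  set t : Fin 4 → ℝ := ![l2, l3 * l1, l3 * l2, l3 * l3] with ht
  have hsum : ∑ k, t k ^ 2 = l2 ^ 2 + l3 ^ 2 * (l1 ^ 2 + l2 ^ 2 + l3 ^ 2) := by
    simp only [ht, Fin.sum_univ_four, cons_val]
    ring
  refine ⟨fun x => ∑ j, ((bellSign 4 j x * (t j / √(∑ k, t k ^ 2)) : ℝ) : ℂ) • twoQubitClifford j,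
    twoQubitClifford, fun x => ?_, IsDichotomic.of_clifford _ twoQubitClifford_isHermitian
      twoQubitClifford_anticommutator, ?_⟩
  · refine isDichotomic_sum_smul_of_clifford _ twoQubitClifford_isHermitian
      twoQubitClifford_anticommutator _ ?_
    have hpos' : 0 < ∑ k, t k ^ 2 := hsum ▸ hpos
    simp only [mul_pow, sq (bellSign _ _ _), bellSign_mul_self, one_mul, div_pow,
      Real.sq_sqrt hpos'.le]
    rw [← Finset.sum_div, div_self hpos'.ne']
  · rw [bellValue_clifford _ _ _ t
      (trace_twoQubitClifford_kronecker_mul_twoCopies l1 l2 l3), hsum]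
    norm_num
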